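/- arXiv:2101.12091 — 5 statements merged into one kernel-verified Lean document; each statement's English description precedes it below -/
import Mathlib

section
/- Let l be a positive integer and let E, W ∈ ℂ^{l×l} be Hermitian positive definite matrices. Then Re(tr(W·E)) − log((det W).re) ≥ l + log((det E).re), with equality if and only if W = E⁻¹. In particular, over all Hermitian positive definite W, the function W ↦ Re(tr(W·E)) − log((det W).re) attains its minimum uniquely at W = E⁻¹. -/
open Matrix ComplexOrder

theorem aux_exists {l : ℕ} (E : Matrix (Fin l) (Fin l) ℂ) (hE : E.PosDef) :
    ∃ B : Matrix (Fin l) (Fin l) ℂ, E = Bᴴ * B := by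
  open scoped MatrixOrder Matrix.Norms.L2Operator in
  exact CStarAlgebra.nonneg_iff_eq_star_mul_self.mp (Matrix.nonneg_iff_posSemidef.mpr hE.posSemidef)

theorem aux_main {l : ℕ} (M : Matrix (Fin l) (Fin l) ℂ) (hM : M.PosDef) :
    (l : ℝ) + Real.log M.det.re ≤ M.trace.re ∧
    (M.trace.re = (l : ℝ) + Real.log M.det.re → M = 1) := by
  have hp := hM.eigenvalues_pos
  set e := hM.1.eigenvalues with he
  have hd : M.det.re = ∏ i, e i := by
    rw [hM.1.det_eq_prod_eigenvalues, ← RCLike.ofReal_prod]; rfl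
  have ht : M.trace.re = ∑ i, e i := by
    rw [hM.1.trace_eq_sum_eigenvalues, ← RCLike.ofReal_sum]; rfl
  have hlog : Real.log (∏ i, e i) = ∑ i, Real.log (e i) :=
    Real.log_prod (fun i _ => (hp i).ne')
  have hl : (l : ℝ) = ∑ _i : Fin l, (1 : ℝ) := by simp
  have hle : ∀ i ∈ Finset.univ, 1 + Real.log (e i) ≤ e i := fun i _ => by
    linarith [Real.log_le_sub_one_of_pos (hp i)]
  rw [hd, ht, hlog, hl, ← Finset.sum_add_distrib]
  refine ⟨Finset.sum_le_sum hle, fun h => ?_⟩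
  have h1 := (Finset.sum_eq_sum_iff_of_le hle).mp h.symm
  have h2 : e = fun _ => 1 := by
    funext i
    by_contra hne
    have := Real.log_lt_sub_one_of_pos (hp i) hne
    have := h1 i (Finset.mem_univ i)
    linarith
  have h3 := hM.1.spectral_theorem
  rw [← he, h2] at h3
  have h4 : (diagonal (RCLike.ofReal ∘ (fun _ => (1:ℝ))) : Matrix (Fin l) (Fin l) ℂ) = 1 := by
    ext i j
    simp [diagonal_apply, one_apply]
  rw [h4, map_one] at h3
  exact h3

/-- For Hermitian positive definite `E, W ∈ ℂ^{l×l}`,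
`Re(tr(W·E)) − log((det W).re) ≥ l + log((det E).re)`, with equality iff `W = E⁻¹`;
hence the minimum over Hermitian positive definite `W` is attained uniquely at `W = E⁻¹`. -/
theorem stmt_0 (l : ℕ) (hl : 0 < l) (E W : Matrix (Fin l) (Fin l) ℂ)
    (hE : E.PosDef) (hW : W.PosDef) :
    (l : ℝ) + Real.log E.det.re ≤ (W * E).trace.re - Real.log W.det.re ∧
    ((W * E).trace.re - Real.log W.det.re = (l : ℝ) + Real.log E.det.re ↔ W = E⁻¹) := by
  obtain ⟨B, hB⟩ := aux_exists E hE
  have hBu : IsUnit B := by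
    have h := hE.isUnit
    rw [Matrix.isUnit_iff_isUnit_det] at h ⊢
    rw [hB, det_mul] at h
    exact isUnit_of_mul_isUnit_right h
  have hM : (B * W * Bᴴ).PosDef := (Matrix.IsUnit.posDef_star_right_conjugate_iff hBu).mpr hW
  have htr : (B * W * Bᴴ).trace = (W * E).trace := by
    rw [hB, Matrix.mul_assoc, trace_mul_comm, Matrix.mul_assoc]
  have hdet : (B * W * Bᴴ).det = W.det * E.det := by
    rw [hB]; simp only [det_mul]; ring
  have hE0 := Complex.pos_iff.mp hE.det_pos
  have hW0 := Complex.pos_iff.mp hW.det_pos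
  have hlog : Real.log (B * W * Bᴴ).det.re = Real.log W.det.re + Real.log E.det.re := by
    rw [hdet, Complex.mul_re, ← hE0.2, ← hW0.2, mul_zero, sub_zero,
      Real.log_mul hW0.1.ne' hE0.1.ne']
  obtain ⟨h1, h2⟩ := aux_main _ hM
  rw [htr, hlog] at h1 h2
  refine ⟨by linarith, fun h => ?_, fun h => ?_⟩
  · have h3 := h2 (by linarith)
    have h4 : B * (W * Bᴴ) = 1 := by rw [← Matrix.mul_assoc]; exact h3
    have h5 := mul_eq_one_comm.mp h4
    refine (Matrix.inv_eq_left_inv ?_).symm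
    rw [hB, ← Matrix.mul_assoc]; exact h5
  · have h3 : W * E = 1 := by
      rw [h]; exact Matrix.nonsing_inv_mul _ ((Matrix.isUnit_iff_isUnit_det _).mp hE.isUnit)
    have h4 : Real.log W.det.re + Real.log E.det.re = 0 := by
      rw [← hlog, hdet, ← det_mul, h3]; simp
    rw [h3]
    simp
    linarith
end

section
/- Let M, N, l be positive integers, H ∈ ℂ^{N×M}, V ∈ ℂ^{M×l}, and σ > 0. Then for every U ∈ ℂ^{N×l}, Re(tr(E(U))) ≥ Re(tr(E(U_mmse))), i.e. the MMSE receiver U_mmse minimizes the trace of the MSE matrix over all receive beamforming matrices. -/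
open Matrix

lemma key_aux {N l : ℕ} (G W D : Matrix (Fin N) (Fin l) ℂ) (σ : ℝ)
    (h : (G * Gᴴ + ((σ : ℂ) ^ 2) • (1 : Matrix (Fin N) (Fin N) ℂ)) * W = G) :
    ((W + D)ᴴ * G - 1) * ((W + D)ᴴ * G - 1)ᴴ + ((σ : ℂ) ^ 2) • ((W + D)ᴴ * (W + D))
    = ((Wᴴ * G - 1) * (Wᴴ * G - 1)ᴴ + ((σ : ℂ) ^ 2) • (Wᴴ * W))
      + ((Dᴴ * G) * (Dᴴ * G)ᴴ + (σ • D)ᴴ * (σ • D)) := by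
  have h1 : Dᴴ * (G * (Gᴴ * W)) + ((σ : ℂ) ^ 2) • (Dᴴ * W) = Dᴴ * G := by
    conv_rhs => rw [← h]
    simp [Matrix.add_mul, Matrix.mul_add, Matrix.mul_assoc]
  have h2 : Wᴴ * (G * (Gᴴ * D)) + ((σ : ℂ) ^ 2) • (Wᴴ * D) = Gᴴ * D := by
    have := congrArg conjTranspose h1
    simpa [Matrix.mul_assoc, conjTranspose_smul] using this
  have h3 : (σ • D)ᴴ * (σ • D) = ((σ : ℂ) ^ 2) • (Dᴴ * D) := by
    ext i j
    simp [Matrix.mul_apply, Finset.mul_sum]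
    refine Finset.sum_congr rfl fun x _ => by ring
  rw [h3]
  simp only [conjTranspose_add, conjTranspose_sub, conjTranspose_mul, conjTranspose_one,
    conjTranspose_conjTranspose, Matrix.add_mul, Matrix.mul_add, Matrix.sub_mul, Matrix.mul_sub,
    Matrix.one_mul, Matrix.mul_one, Matrix.mul_assoc, smul_add]
  rw [eq_sub_of_add_eq h1, eq_sub_of_add_eq h2]
  abel

open scoped ComplexOrder

/-- The MMSE receiver `U_mmse = (H·V·Vᴴ·Hᴴ + σ²·I)⁻¹·H·V` minimizes the trace of the
MSE matrix `E(U) = (Uᴴ·H·V − I)(Uᴴ·H·V − I)ᴴ + σ²·Uᴴ·U` over all receive beamforming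
matrices `U`. -/
theorem stmt_1 (M N l : ℕ) (hM : 0 < M) (hN : 0 < N) (hl : 0 < l)
    (H : Matrix (Fin N) (Fin M) ℂ) (V : Matrix (Fin M) (Fin l) ℂ)
    (σ : ℝ) (hσ : 0 < σ) :
    let Emat : Matrix (Fin N) (Fin l) ℂ → Matrix (Fin l) (Fin l) ℂ :=
      fun U => (Uᴴ * H * V - 1) * (Uᴴ * H * V - 1)ᴴ + ((σ : ℂ) ^ 2) • (Uᴴ * U)
    let Ummse : Matrix (Fin N) (Fin l) ℂ :=
      (H * V * Vᴴ * Hᴴ + ((σ : ℂ) ^ 2) • 1)⁻¹ * H * V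
    ∀ U : Matrix (Fin N) (Fin l) ℂ, (Emat Ummse).trace.re ≤ (Emat U).trace.re := by
  intro Emat Ummse U
  have hp : (H * V * Vᴴ * Hᴴ + ((σ : ℂ) ^ 2) • (1 : Matrix (Fin N) (Fin N) ℂ)).PosDef := by
    have e : H * V * Vᴴ * Hᴴ = (H * V) * (H * V)ᴴ := by
      simp [Matrix.mul_assoc]
    rw [e]
    refine Matrix.PosDef.posSemidef_add (posSemidef_self_mul_conjTranspose _) ?_
    refine Matrix.PosDef.smul Matrix.PosDef.one ?_
    have : (0:ℝ) < σ ^ 2 := by positivity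
    exact_mod_cast this
  have hd := (Matrix.isUnit_iff_isUnit_det _).1 hp.isUnit
  have hW : ((H * V) * (H * V)ᴴ + ((σ : ℂ) ^ 2) • (1 : Matrix (Fin N) (Fin N) ℂ)) * Ummse
      = H * V := by
    have e : (H * V) * (H * V)ᴴ = H * V * Vᴴ * Hᴴ := by
      simp [Matrix.mul_assoc]
    rw [e]
    simp only [Ummse]
    rw [Matrix.mul_assoc _ H V, Matrix.mul_nonsing_inv_cancel_left _ _ hd]
  have k := key_aux (H * V) Ummse (U - Ummse) σ hW
  rw [add_sub_cancel] at k
  have hE : ∀ X, Emat X = (Xᴴ * (H * V) - 1) * (Xᴴ * (H * V) - 1)ᴴ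
      + ((σ : ℂ) ^ 2) • (Xᴴ * X) := by
    intro X
    simp only [Emat, Matrix.mul_assoc _ H V]
  rw [← hE, ← hE] at k
  clear_value Emat
  rw [k, Matrix.trace_add, Complex.add_re]
  have n1 := ((posSemidef_self_mul_conjTranspose ((U - Ummse)ᴴ * (H * V))).add
    (posSemidef_conjTranspose_mul_self (σ • (U - Ummse)))).trace_nonneg
  have n2 := (Complex.le_def.1 n1).1
  rw [Complex.zero_re] at n2
  linarith
end

section
/- Let M, N, l be positive integers, H ∈ ℂ^{N×M}, V ∈ ℂ^{M×l}, and let R ∈ ℂ^{N×N} be Hermitian positive definite. Let E_mmse = I_l − Vᴴ·Hᴴ·R⁻¹·(H·V·Vᴴ·Hᴴ·R⁻¹ + I_N)⁻¹·H·V. Then det(E_mmse) · det(I_N + H·V·Vᴴ·Hᴴ·R⁻¹) = 1. -/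
open Matrix ComplexOrder

/-- With `E_mmse = I − Vᴴ·Hᴴ·R⁻¹·(H·V·Vᴴ·Hᴴ·R⁻¹ + I)⁻¹·H·V` for Hermitian positive
definite `R`, one has `det(E_mmse) · det(I + H·V·Vᴴ·Hᴴ·R⁻¹) = 1`. -/
theorem stmt_4 (M N l : ℕ) (hM : 0 < M) (hN : 0 < N) (hl : 0 < l)
    (H : Matrix (Fin N) (Fin M) ℂ) (V : Matrix (Fin M) (Fin l) ℂ)
    (R : Matrix (Fin N) (Fin N) ℂ) (hR : R.PosDef) :
    let Emmse : Matrix (Fin l) (Fin l) ℂ :=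
      1 - Vᴴ * Hᴴ * R⁻¹ * (H * V * Vᴴ * Hᴴ * R⁻¹ + 1)⁻¹ * H * V
    Emmse.det * (1 + H * V * Vᴴ * Hᴴ * R⁻¹).det = 1 := by
  intro Emmse
  set K : Matrix (Fin N) (Fin N) ℂ := H * V * Vᴴ * Hᴴ * R⁻¹ with hK
  have hpd : (1 + (H * V)ᴴ * R⁻¹ * (H * V)).PosDef :=
    PosDef.one.add_posSemidef (hR.inv.posSemidef.conjTranspose_mul_mul_same (H * V))
  have hdet : (K + 1).det ≠ 0 := by
    have h1 : K + 1 = 1 + (H * V) * ((H * V)ᴴ * R⁻¹) := by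
      rw [hK, add_comm, conjTranspose_mul]
      simp only [Matrix.mul_assoc]
    rw [h1, det_one_add_mul_comm]
    exact hpd.det_pos.ne'
  have hu : IsUnit (K + 1).det := isUnit_iff_ne_zero.mpr hdet
  have hE : Emmse.det = (1 - K * (K + 1)⁻¹).det := by
    have h2 : Emmse = 1 - (Vᴴ * Hᴴ * R⁻¹ * (K + 1)⁻¹) * (H * V) := by
      simp only [Emmse, hK, Matrix.mul_assoc]
    rw [h2, det_one_sub_mul_comm, hK]
    simp only [Matrix.mul_assoc]
  rw [hE, add_comm 1 K, ← det_mul, Matrix.sub_mul, Matrix.mul_assoc,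
    nonsing_inv_mul _ hu, Matrix.mul_one, Matrix.one_mul, add_sub_cancel_left, det_one]
end

section
/- Let M, N, l be positive integers, H ∈ ℂ^{N×M}, V ∈ ℂ^{M×l}, and σ > 0. Then for every U ∈ ℂ^{N×l} and every Hermitian positive definite W ∈ ℂ^{l×l}, Re(tr(W·E(U))) − log((det W).re) ≥ l − log((det(I_N + σ⁻²·H·V·Vᴴ·Hᴴ)).re). (This is the lower-bound half of the equivalence between the weighted MSE minimization problem and the throughput maximization problem.) -/
open Matrix ComplexOrder

theorem aux_trace_logdet {l : ℕ} (D : Matrix (Fin l) (Fin l) ℂ) (hD : D.PosDef) :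
    (l : ℝ) ≤ D.trace.re - Real.log D.det.re := by
  have h1 : D.trace.re = ∑ i, hD.1.eigenvalues i := by
    rw [hD.1.trace_eq_sum_eigenvalues]; simp
  have h2 : D.det.re = ∏ i, hD.1.eigenvalues i := by
    rw [hD.1.det_eq_prod_eigenvalues]
    rw [← Complex.ofReal_re (∏ i, hD.1.eigenvalues i)]
    push_cast
    rfl
  rw [h1, h2, Real.log_prod (fun i _ => (hD.eigenvalues_pos i).ne'), ← Finset.sum_sub_distrib]
  have : (l : ℝ) = ∑ i : Fin l, (1 : ℝ) := by simp
  rw [this]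
  refine Finset.sum_le_sum fun i _ => ?_
  have := Real.log_le_sub_one_of_pos (hD.eigenvalues_pos i)
  linarith

theorem aux_trace_mul {l n : ℕ} (W : Matrix (Fin l) (Fin l) ℂ) (hW : W.PosDef)
    (Y : Matrix (Fin l) (Fin n) ℂ) : 0 ≤ (W * (Y * Yᴴ)).trace.re := by
  have h := (hW.posSemidef.conjTranspose_mul_mul_same Y).trace_nonneg
  rw [Matrix.mul_assoc, Matrix.trace_mul_comm, Matrix.mul_assoc] at h
  exact (Complex.le_def.1 h).1

open scoped MatrixOrder in
theorem aux_WK {l : ℕ} (W K : Matrix (Fin l) (Fin l) ℂ) (hW : W.PosDef) (hK : K.PosDef) :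
    (l : ℝ) - Real.log K.det.re ≤ (W * K⁻¹).trace.re - Real.log W.det.re := by
  obtain ⟨B, hB⟩ := CStarAlgebra.nonneg_iff_eq_star_mul_self.1 hK.inv.posSemidef.nonneg
  rw [star_eq_conjTranspose] at hB
  have hKd := hK.det_pos
  have hWd := hW.det_pos
  have hdet : Bᴴ.det * B.det = K.det⁻¹ := by
    rw [← det_mul, ← hB, det_nonsing_inv, Ring.inverse_eq_inv']
  have hBd : Bᴴ.det ≠ 0 := by
    intro h
    rw [h, zero_mul] at hdet
    exact inv_ne_zero hKd.ne' hdet.symm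
  have hBu : IsUnit Bᴴ := (isUnit_iff_isUnit_det _).2 (isUnit_iff_ne_zero.2 hBd)
  have hD : (B * W * Bᴴ).PosDef := by
    have := (hW.mul_mul_conjTranspose_same (B := B) (vecMul_injective_of_isUnit (by simpa using hBu.star)))
    exact this
  have h := aux_trace_logdet _ hD
  have ht : (B * W * Bᴴ).trace = (W * K⁻¹).trace := by
    rw [hB, Matrix.mul_assoc, Matrix.trace_mul_comm, Matrix.mul_assoc]
  have hd : (B * W * Bᴴ).det = W.det * K.det⁻¹ := by
    rw [← hdet, det_mul, det_mul]; ring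
  have hKr : K.det = (K.det.re : ℂ) := Complex.eq_re_of_ofReal_le hKd.le
  have hWr : W.det = (W.det.re : ℂ) := Complex.eq_re_of_ofReal_le hWd.le
  have hd2 : (B * W * Bᴴ).det.re = W.det.re * K.det.re⁻¹ := by
    rw [hd, hKr, hWr, ← Complex.ofReal_inv, ← Complex.ofReal_mul]
    simp
  have a : 0 < K.det.re := (Complex.lt_def.1 hKd).1
  have b : 0 < W.det.re := (Complex.lt_def.1 hWd).1
  rw [ht, hd2, Real.log_mul b.ne' (inv_pos.2 a).ne', Real.log_inv] at h
  linarith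

theorem aux_E {N l : ℕ} (G : Matrix (Fin N) (Fin l) ℂ) (X : Matrix (Fin l) (Fin N) ℂ)
    (K J : Matrix (Fin l) (Fin l) ℂ) (s : ℝ) (hs : 0 < s)
    (hK : K = 1 + (s : ℂ)⁻¹ • (Gᴴ * G)) (hJ : J * K = 1) (hJh : Jᴴ = J) :
    (X * G - 1) * (X * G - 1)ᴴ + (s : ℂ) • (X * Xᴴ) =
    J + ((s : ℂ) • ((X - (s : ℂ)⁻¹ • (J * Gᴴ)) * (X - (s : ℂ)⁻¹ • (J * Gᴴ))ᴴ)
      + (X * G - 1 + J) * (X * G - 1 + J)ᴴ) := by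
  have hs' : (s : ℂ) ≠ 0 := by exact_mod_cast hs.ne'
  have hJ2 : J * J + (s : ℂ)⁻¹ • (J * (Gᴴ * (G * J))) = J := by
    have : J * K * J = J := by rw [hJ, Matrix.one_mul]
    rw [hK] at this
    simpa [Matrix.mul_add, Matrix.add_mul, Matrix.mul_assoc] using this
  have e : (s : ℂ) • ((X - (s : ℂ)⁻¹ • (J * Gᴴ)) * (X - (s : ℂ)⁻¹ • (J * Gᴴ))ᴴ)
      = (s : ℂ) • (X * Xᴴ) - X * (G * J) - J * (Gᴴ * Xᴴ)
        + (s : ℂ)⁻¹ • (J * (Gᴴ * (G * J))) := by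
    simp only [conjTranspose_sub, conjTranspose_smul, conjTranspose_mul, conjTranspose_conjTranspose,
      hJh, Matrix.mul_sub, Matrix.sub_mul, Matrix.smul_mul, Matrix.mul_smul, smul_sub, smul_smul,
      Matrix.mul_assoc, star_inv₀, Complex.star_def, Complex.conj_ofReal]
    rw [mul_inv_cancel₀ hs', one_smul, one_smul, ← mul_assoc, mul_inv_cancel₀ hs', one_mul]
    abel
  rw [e]
  simp only [conjTranspose_sub, conjTranspose_add, conjTranspose_mul, conjTranspose_one,
      hJh, Matrix.mul_sub, Matrix.sub_mul, Matrix.mul_add, Matrix.add_mul, Matrix.mul_assoc,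
      Matrix.mul_one, Matrix.one_mul]
  have hJ3 := eq_sub_of_add_eq hJ2
  rw [hJ3]
  abel

/-- Lower-bound half of the equivalence between weighted MSE minimization and throughput
maximization: for every receiver `U` and Hermitian positive definite weight `W`,
`Re(tr(W·E(U))) − log((det W).re) ≥ l − log((det(I + σ⁻²·H·V·Vᴴ·Hᴴ)).re)`. -/
theorem stmt_5 (M N l : ℕ) (hM : 0 < M) (hN : 0 < N) (hl : 0 < l)
    (H : Matrix (Fin N) (Fin M) ℂ) (V : Matrix (Fin M) (Fin l) ℂ)
    (σ : ℝ) (hσ : 0 < σ) :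
    ∀ (U : Matrix (Fin N) (Fin l) ℂ) (W : Matrix (Fin l) (Fin l) ℂ), W.PosDef →
      (l : ℝ) - Real.log ((1 + (((σ : ℂ) ^ 2)⁻¹) • (H * V * Vᴴ * Hᴴ)).det.re) ≤
      (W * ((Uᴴ * H * V - 1) * (Uᴴ * H * V - 1)ᴴ + ((σ : ℂ) ^ 2) • (Uᴴ * U))).trace.re -
        Real.log W.det.re := by
  intro U W hW
  have hs : 0 < σ ^ 2 := by positivity
  obtain ⟨G, hG⟩ : ∃ G, G = H * V := ⟨_, rfl⟩
  have hG1 : H * V * Vᴴ * Hᴴ = G * Gᴴ := by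
    rw [hG, conjTranspose_mul, Matrix.mul_assoc (H * V)]
  rw [hG1, Matrix.mul_assoc Uᴴ, ← hG, ← Complex.ofReal_pow]
  generalize σ ^ 2 = s at hs
  obtain ⟨K, hKe⟩ : ∃ K, K = 1 + (s : ℂ)⁻¹ • (Gᴴ * G) := ⟨_, rfl⟩
  have hdet : (1 + (s : ℂ)⁻¹ • (G * Gᴴ)).det = K.det := by
    rw [hKe, ← Matrix.smul_mul, det_one_add_mul_comm, Matrix.mul_smul]
  have hK : K.PosDef := by
    rw [hKe]
    refine PosDef.one.add_posSemidef ((posSemidef_conjTranspose_mul_self G).smul ?_)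
    rw [← Complex.ofReal_inv]
    exact_mod_cast (inv_pos.2 hs).le
  have hJ : K⁻¹ * K = 1 := nonsing_inv_mul _ (isUnit_iff_ne_zero.2 hK.det_pos.ne')
  have hE := aux_E G Uᴴ K K⁻¹ s hs hKe hJ hK.inv.1
  rw [conjTranspose_conjTranspose] at hE
  rw [hdet, hE, Matrix.mul_add, Matrix.mul_add, Matrix.mul_smul, trace_add, trace_add, trace_smul,
    Complex.add_re, Complex.add_re, smul_eq_mul, Complex.re_ofReal_mul]
  have h1 := aux_WK W K hW hK
  have h2 := mul_nonneg hs.le (aux_trace_mul W hW (Uᴴ - (s : ℂ)⁻¹ • (K⁻¹ * Gᴴ)))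
  have h3 := aux_trace_mul W hW (Uᴴ * G - 1 + K⁻¹)
  linarith
end

section
/- Let M, N, l be positive integers, H ∈ ℂ^{N×M}, V ∈ ℂ^{M×l}, and σ > 0. Then E_mmse is Hermitian positive definite, and choosing U = U_mmse and W = E_mmse⁻¹ achieves Re(tr(W·E(U))) − log((det W).re) = l − log((det(I_N + σ⁻²·H·V·Vᴴ·Hᴴ)).re). (Together with the lower bound, this establishes that the weighted MSE minimization problem is equivalent to the throughput maximization problem.) -/
open Matrix ComplexOrder

theorem aux_mmse {N l : ℕ} (G : Matrix (Fin N) (Fin l) ℂ) (s : ℂ) (hs : 0 < s)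
    (hss : star s = s) :
    (1 - Gᴴ * (G * Gᴴ + s • 1)⁻¹ * G)⁻¹ = 1 + s⁻¹ • (Gᴴ * G) ∧
    (1 - Gᴴ * (G * Gᴴ + s • 1)⁻¹ * G).PosDef ∧
    ((((G * Gᴴ + s • 1)⁻¹ * G)ᴴ * G - 1) * (((G * Gᴴ + s • 1)⁻¹ * G)ᴴ * G - 1)ᴴ +
      s • (((G * Gᴴ + s • 1)⁻¹ * G)ᴴ * ((G * Gᴴ + s • 1)⁻¹ * G)))
      = 1 - Gᴴ * (G * Gᴴ + s • 1)⁻¹ * G := by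
  have hs0 : s ≠ 0 := hs.ne'
  have hA : (G * Gᴴ + s • (1 : Matrix (Fin N) (Fin N) ℂ)).PosDef :=
    Matrix.PosDef.posSemidef_add (posSemidef_self_mul_conjTranspose G)
      (Matrix.PosDef.one.smul hs)
  have hP : (1 + s⁻¹ • (Gᴴ * G)).PosDef :=
    Matrix.PosDef.one.add_posSemidef
      ((posSemidef_conjTranspose_mul_self G).smul (inv_nonneg.2 hs.le))
  have hBH : ((G * Gᴴ + s • (1 : Matrix (Fin N) (Fin N) ℂ))⁻¹)ᴴ = (G * Gᴴ + s • 1)⁻¹ :=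
    hA.inv.isHermitian
  have hBA : (G * Gᴴ + s • (1 : Matrix (Fin N) (Fin N) ℂ))⁻¹ * (G * Gᴴ + s • 1) = 1 :=
    Matrix.nonsing_inv_mul _ ((Matrix.isUnit_iff_isUnit_det _).1 hA.isUnit)
  generalize (G * Gᴴ + s • (1 : Matrix (Fin N) (Fin N) ℂ))⁻¹ = B at *
  have hB1 : B * (G * Gᴴ) = 1 - s • B := by
    rw [mul_add, mul_smul_comm, mul_one] at hBA
    exact eq_sub_of_add_eq hBA
  have hK : Gᴴ * B * G * (Gᴴ * G) = Gᴴ * G - s • (Gᴴ * B * G) := by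
    calc _ = Gᴴ * (B * (G * Gᴴ)) * G := by simp only [Matrix.mul_assoc]
      _ = _ := by rw [hB1]; simp [Matrix.mul_sub, Matrix.sub_mul]
  have hK2 : Gᴴ * B * G * (Gᴴ * B * G) = Gᴴ * B * G - s • (Gᴴ * B * (B * G)) := by
    calc _ = Gᴴ * (B * (G * Gᴴ)) * B * G := by simp only [Matrix.mul_assoc]
      _ = _ := by rw [hB1]; simp [Matrix.mul_sub, Matrix.sub_mul, Matrix.mul_assoc]
  have hEP : (1 - Gᴴ * B * G) * (1 + s⁻¹ • (Gᴴ * G)) = 1 := by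
    rw [sub_mul, one_mul, mul_add, mul_one, mul_smul_comm, hK, smul_sub, smul_smul,
      inv_mul_cancel₀ hs0, one_smul]
    abel
  refine ⟨Matrix.inv_eq_right_inv hEP, ?_, ?_⟩
  · rw [← Matrix.inv_eq_left_inv hEP]
    exact hP.inv
  · have h1 : (B * G)ᴴ = Gᴴ * B := by rw [conjTranspose_mul, hBH]
    have h2 : (Gᴴ * B * G - 1)ᴴ = Gᴴ * B * G - 1 := by
      simp [conjTranspose_mul, hBH, Matrix.mul_assoc]
    rw [h1, h2, sub_mul, mul_sub, hK2, one_mul, mul_one]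
    abel

/-- `E_mmse` is Hermitian positive definite, and the choice `U = U_mmse`, `W = E_mmse⁻¹`
achieves `Re(tr(W·E(U))) − log((det W).re) = l − log((det(I + σ⁻²·H·V·Vᴴ·Hᴴ)).re)`. -/
theorem stmt_6 (M N l : ℕ) (hM : 0 < M) (hN : 0 < N) (hl : 0 < l)
    (H : Matrix (Fin N) (Fin M) ℂ) (V : Matrix (Fin M) (Fin l) ℂ)
    (σ : ℝ) (hσ : 0 < σ) :
    let Ummse : Matrix (Fin N) (Fin l) ℂ :=
      (H * V * Vᴴ * Hᴴ + ((σ : ℂ) ^ 2) • 1)⁻¹ * H * V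
    let Emmse : Matrix (Fin l) (Fin l) ℂ :=
      1 - Vᴴ * Hᴴ * (H * V * Vᴴ * Hᴴ + ((σ : ℂ) ^ 2) • 1)⁻¹ * H * V
    Emmse.PosDef ∧
    (Emmse⁻¹ * ((Ummseᴴ * H * V - 1) * (Ummseᴴ * H * V - 1)ᴴ +
        ((σ : ℂ) ^ 2) • (Ummseᴴ * Ummse))).trace.re - Real.log (Emmse⁻¹).det.re =
      (l : ℝ) - Real.log ((1 + (((σ : ℂ) ^ 2)⁻¹) • (H * V * Vᴴ * Hᴴ)).det.re) := by
  intro Ummse Emmse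
  have hs : (0 : ℂ) < (σ : ℂ) ^ 2 := by
    have : (0 : ℝ) < σ ^ 2 := by positivity
    exact_mod_cast this
  have hss : star ((σ : ℂ) ^ 2) = (σ : ℂ) ^ 2 := by simp
  obtain ⟨h1, h2, h3⟩ := aux_mmse (H * V) ((σ : ℂ) ^ 2) hs hss
  have e0 : H * V * Vᴴ * Hᴴ = H * V * (H * V)ᴴ := by
    rw [conjTranspose_mul]; simp only [Matrix.mul_assoc]
  have eE : Emmse = 1 - (H * V)ᴴ * (H * V * (H * V)ᴴ + ((σ : ℂ) ^ 2) • 1)⁻¹ * (H * V) := by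
    simp only [Emmse, e0]
    simp only [conjTranspose_mul, Matrix.mul_assoc]
  have eU : Ummse = (H * V * (H * V)ᴴ + ((σ : ℂ) ^ 2) • 1)⁻¹ * (H * V) := by
    simp only [Ummse, e0]
    simp only [Matrix.mul_assoc]
  rw [← eE, ← eU] at h3
  rw [← eE] at h1 h2
  refine ⟨h2, ?_⟩
  have hinv : Emmse⁻¹ * Emmse = 1 :=
    Matrix.nonsing_inv_mul _ ((Matrix.isUnit_iff_isUnit_det _).1 h2.isUnit)
  rw [Matrix.mul_assoc Ummseᴴ H V, h3, hinv, h1, e0, ← Matrix.smul_mul,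
    Matrix.det_one_add_mul_comm, Matrix.mul_smul]
  simp
end
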